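/- arXiv:math/0607812 — 3 statements merged into one kernel-verified Lean document; each statement's English description precedes it below -/
import Mathlib

section
/- Let ν be a Borel probability measure on ℝ invariant under x ↦ −x, with cdf H, and let μ ≠ 0 be real. Let F(x) = (1/2)H(x−μ) + (1/2)H(x+μ), which is the cdf of a symmetric distribution. Then F ≠ H, and for every μ₂ ∈ ℝ and every x ∈ ℝ one has F(x−μ₂) = (1/2)H(x−(μ₂+μ)) + (1/2)H(x−(μ₂−μ)). Consequently the quadruple (λ, μ₁, μ₂, F) with λ = 0 and the quadruple (λ′, μ₁′, μ₂′, F′) = (1/2, μ₂+μ, μ₂−μ, H) produce the same mixture cdf although F ≠ F′: the two-component shifted symmetric mixture model is not identifiable when the mixing proportion is allowed to equal 1/2. -/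
open MeasureTheory

/-- `F` is the cumulative distribution function of a Borel probability measure on `ℝ`
that is invariant under the map `x ↦ -x`. -/
def IsSymmCDF (F : ℝ → ℝ) : Prop :=
  ∃ ν : Measure ℝ, IsProbabilityMeasure ν ∧ ν.map (fun x => -x) = ν ∧
    ∀ x : ℝ, F x = (ν (Set.Iic x)).toReal

open Filter Topology ProbabilityTheory

/-- A bounded function that satisfies the midpoint equation with step `c` is `c`-periodic. -/
theorem periodic_of_midpoint_of_bounded {f : ℝ → ℝ} {c C : ℝ} (hb : ∀ x, |f x| ≤ C)
    (hf : ∀ x, f x = (1 / 2) * f (x - c) + (1 / 2) * f (x + c)) : Function.Periodic f c := by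
  intro x
  have hstep (n : ℕ) : f (x + n * c) = f x + n * (f (x + c) - f x) ∧
      f (x + (n + 1) * c) = f x + (n + 1) * (f (x + c) - f x) := by
    induction n with
    | zero => simp
    | succ k ih =>
      have h := hf (x + (k + 1) * c)
      rw [show x + (k + 1) * c - c = x + k * c by ring,
        show x + (k + 1) * c + c = x + (k + 1 + 1) * c by ring] at h
      push_cast
      exact ⟨ih.2, by linarith [ih.1, ih.2]⟩
  by_contra hne
  have hpos : 0 < |f (x + c) - f x| := abs_pos.mpr (sub_ne_zero.mpr hne)
  obtain ⟨n, hn⟩ := exists_nat_gt (2 * C / |f (x + c) - f x|)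
  rw [div_lt_iff₀ hpos] at hn
  have h : (n : ℝ) * |f (x + c) - f x| = |f (x + n * c) - f x| := by
    rw [(hstep n).1, add_sub_cancel_left, abs_mul, Nat.abs_cast]
  have := abs_sub (f (x + n * c)) (f x)
  linarith [hb x, hb (x + n * c)]

/-- The cdf of a probability measure has no nonzero period. -/
theorem not_periodic_cdf (ν : Measure ℝ) {c : ℝ} (hc : c ≠ 0) :
    ¬ Function.Periodic (cdf ν) c := by
  intro h
  have h' : Function.Periodic (cdf ν) |c| := by
    rcases abs_choice c with hc' | hc' <;> rw [hc']
    exacts [h, h.neg]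
  have ht : Tendsto (fun n : ℕ => (n : ℝ) * |c|) atTop atTop :=
    tendsto_natCast_atTop_atTop.atTop_mul_const (abs_pos.mpr hc)
  have h1 := (tendsto_cdf_atTop ν).comp ht
  have h0 := (tendsto_cdf_atBot ν).comp (tendsto_neg_atTop_atBot.comp ht)
  have e1 : cdf ν ∘ (fun n : ℕ => (n : ℝ) * |c|) = fun _ => cdf ν 0 := by
    funext n
    exact h'.nat_mul_eq n
  have e0 : cdf ν ∘ (Neg.neg ∘ fun n : ℕ => (n : ℝ) * |c|) = fun _ => cdf ν 0 := by
    funext n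
    exact (h'.nat_mul n).neg_eq
  rw [e1] at h1
  rw [e0] at h0
  have := tendsto_nhds_unique h1 tendsto_const_nhds
  have := tendsto_nhds_unique h0 tendsto_const_nhds
  linarith

/-- The balanced mixture of the shifts by `c` and `-c` of a symmetric cdf is a symmetric cdf. -/
theorem isSymmCDF_balanced_mixture (ν : Measure ℝ) [IsProbabilityMeasure ν]
    (hsym : ν.map (fun x => -x) = ν) (c : ℝ) :
    IsSymmCDF fun x => (1 / 2) * (ν (Set.Iic (x - c))).toReal
      + (1 / 2) * (ν (Set.Iic (x + c))).toReal := by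
  have hm (a : ℝ) : Measurable fun x : ℝ => x + a := measurable_id.add_const a
  have hreflect (a : ℝ) :
      (ν.map (fun x => x + a)).map (fun x => -x) = ν.map (fun x => x + -a) := by
    conv_rhs => rw [← hsym]
    rw [Measure.map_map measurable_neg (hm a), Measure.map_map (hm _) measurable_neg]
    congr 1
    funext x
    simp [add_comm]
  have hIic (a x : ℝ) : ν.map (fun x => x + a) (Set.Iic x) = ν (Set.Iic (x - a)) := by
    rw [Measure.map_apply (hm a) measurableSet_Iic]
    congr 1
    ext y
    simp [le_sub_iff_add_le]
  refine ⟨(2⁻¹ : ENNReal) • ν.map (fun x => x + c) + (2⁻¹ : ENNReal) • ν.map (fun x => x + -c),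
    ⟨?_⟩, ?_, fun x => ?_⟩
  · simp [Measure.map_apply (hm _) MeasurableSet.univ, ENNReal.inv_two_add_inv_two]
  · rw [Measure.map_add _ _ measurable_neg, Measure.map_smul, Measure.map_smul, hreflect,
      hreflect, neg_neg, add_comm]
  · simp only [Measure.add_apply, Measure.smul_apply, hIic, smul_eq_mul, sub_neg_eq_add]
    rw [ENNReal.toReal_add (by finiteness) (by finiteness), ENNReal.toReal_mul,
      ENNReal.toReal_mul]
    simp

/-- Non-identifiability of the two-component shifted symmetric mixture model when the
mixing proportion is allowed to equal `1/2`: the quadruple `(0, μ₁, μ₂, F)` and the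
quadruple `(1/2, μ₂+μ, μ₂−μ, H)` produce the same mixture cdf although `F ≠ H`. -/
theorem stmt_1 (ν : Measure ℝ) (hprob : IsProbabilityMeasure ν)
    (hsym : ν.map (fun x => -x) = ν)
    (H : ℝ → ℝ) (hH : ∀ x : ℝ, H x = (ν (Set.Iic x)).toReal)
    (mu : ℝ) (hmu : mu ≠ 0)
    (F : ℝ → ℝ) (hF : ∀ x : ℝ, F x = (1 / 2) * H (x - mu) + (1 / 2) * H (x + mu)) :
    IsSymmCDF F ∧ F ≠ H ∧
      (∀ mu₂ x : ℝ, F (x - mu₂) = (1 / 2) * H (x - (mu₂ + mu)) + (1 / 2) * H (x - (mu₂ - mu))) ∧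
      (∀ mu₁ mu₂ x : ℝ,
        (0 : ℝ) * F (x - mu₁) + (1 - (0 : ℝ)) * F (x - mu₂)
          = (1 / 2) * H (x - (mu₂ + mu)) + (1 - (1 / 2 : ℝ)) * H (x - (mu₂ - mu))) := by
  have hmix (mu₂ x : ℝ) :
      F (x - mu₂) = (1 / 2) * H (x - (mu₂ + mu)) + (1 / 2) * H (x - (mu₂ - mu)) := by
    rw [hF, sub_sub, sub_add]
  refine ⟨?_, ?_, hmix, fun mu₁ mu₂ x => ?_⟩
  · have hFν : F = fun x => (1 / 2) * (ν (Set.Iic (x - mu))).toReal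
        + (1 / 2) * (ν (Set.Iic (x + mu))).toReal := by
      funext x
      rw [hF, hH, hH]
    rw [hFν]
    exact isSymmCDF_balanced_mixture ν hsym mu
  · rintro rfl
    have hcdf : F = cdf ν := by
      funext x
      rw [hH, cdf_eq_real, measureReal_def]
    refine not_periodic_cdf ν hmu ?_
    rw [← hcdf]
    refine periodic_of_midpoint_of_bounded (C := 1) (fun x => ?_) hF
    rw [hcdf, abs_of_nonneg (cdf_nonneg ν x)]
    exact cdf_le_one ν x
  · linear_combination hmix mu₂ x
end

section
/- Let θ₀ = (λ₀, μ₁⁰, μ₂⁰) with λ₀ ∈ [0, 1/2), μ₁⁰ ≠ μ₂⁰, F₀ a symmetric cdf, and G = A_{θ₀}F₀. If θ = (λ, μ₁, μ₂) with λ ∈ [0, 1/2) and μ₁ ≠ μ₂ satisfies (A_θ S_r A_θ⁻¹ G)(x) = G(x) for all x ∈ ℝ, then λ = λ₀ and μ₂ = μ₂⁰; moreover, if λ₀ > 0 then also μ₁ = μ₁⁰ (so θ = θ₀). -/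
open MeasureTheory

/-- The mixing operator `A_θ`. -/
noncomputable def Aop (lam mu₁ mu₂ : ℝ) (H : ℝ → ℝ) (x : ℝ) : ℝ :=
  lam * H (x - mu₁) + (1 - lam) * H (x - mu₂)

/-- The inverse mixing operator `A_θ⁻¹`, defined by the geometric series. -/
noncomputable def Ainv (lam mu₁ mu₂ : ℝ) (H : ℝ → ℝ) (x : ℝ) : ℝ :=
  (1 / (1 - lam)) * ∑' k : ℕ, (-lam / (1 - lam)) ^ k * H (x + mu₂ + (k : ℝ) * (mu₂ - mu₁))

/-- The symmetry operator `S_r`. -/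
noncomputable def Sr (H : ℝ → ℝ) (x : ℝ) : ℝ := 1 - H (-x)

open Filter Topology in
theorem MeasureTheory.Measure.ext_of_Iic_eq_Iio {M N : Measure ℝ} [IsFiniteMeasure M]
    (h : ∀ x, M (Set.Iic x) = N (Set.Iio x)) : M = N := by
  refine Measure.ext_of_Iic M N fun x => le_antisymm ?_ ?_
  · rw [h]
    exact measure_mono Set.Iio_subset_Iic_self
  · have hlim : Tendsto (fun y => M (Set.Iic y)) (𝓝[>] x) (𝓝 (M (⋂ y > x, Set.Iic y))) :=
      tendsto_measure_biInter_gt (fun _ _ => measurableSet_Iic.nullMeasurableSet)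
        (fun _ _ _ hij => Set.Iic_subset_Iic.2 hij) ⟨x + 1, by simp, measure_ne_top _ _⟩
    have hI : (⋂ y > x, Set.Iic y) = Set.Iic x := by
      ext z
      simpa using ⟨fun H => le_of_forall_gt_imp_ge_of_dense H, fun H y hy => H.trans hy.le⟩
    rw [hI] at hlim
    refine ge_of_tendsto hlim ?_
    filter_upwards [self_mem_nhdsWithin] with y hy
    rw [h]
    exact measure_mono (Set.Iic_subset_Iio.2 hy)

/-- The mixture of the translates of `ν` by `d i`, with weights `c i`. -/
noncomputable def translateMix {ι : Type*} [Fintype ι] (ν : Measure ℝ) (c d : ι → ℝ) : Measure ℝ :=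
  ∑ i, ENNReal.ofReal (c i) • ν.map (fun x => x + d i)

section translateMix

variable {ι : Type*} [Fintype ι] {ν : Measure ℝ} {c d : ι → ℝ}

instance [IsFiniteMeasure ν] : IsFiniteMeasure (translateMix ν c d) := by
  unfold translateMix
  have (i : ι) : IsFiniteMeasure (ENNReal.ofReal (c i) • ν.map (fun x => x + d i)) :=
    Measure.smul_finite _ ENNReal.ofReal_ne_top
  infer_instance

theorem translateMix_apply [IsFiniteMeasure ν] (hc : ∀ i, 0 ≤ c i) {s : Set ℝ}
    (hs : MeasurableSet s) :
    translateMix ν c d s = ENNReal.ofReal (∑ i, c i * ν.real ((fun x => x + d i) ⁻¹' s)) := by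
  rw [ENNReal.ofReal_sum_of_nonneg fun i _ => mul_nonneg (hc i) measureReal_nonneg]
  simp only [translateMix, Measure.finsetSum_apply, Measure.smul_apply, smul_eq_mul]
  refine Finset.sum_congr rfl fun i _ => ?_
  rw [Measure.map_apply (by fun_prop) hs, ENNReal.ofReal_mul (hc i), ofReal_measureReal]

theorem charFun_translateMix [IsFiniteMeasure ν] (hc : ∀ i, 0 ≤ c i) (t : ℝ) :
    charFun (translateMix ν c d) t =
      (∑ i, (c i : ℂ) * Complex.exp ((d i * t : ℝ) * Complex.I)) * charFun ν t := by
  have hint (i : ι) : Integrable (fun x : ℝ => Complex.exp (t * x * Complex.I))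
      (ENNReal.ofReal (c i) • ν.map (fun x => x + d i)) := by
    refine Integrable.smul_measure ?_ ENNReal.ofReal_ne_top
    refine Integrable.of_bound (by fun_prop) 1 (ae_of_all _ fun x => ?_)
    rw [← Complex.ofReal_mul, Complex.norm_exp_ofReal_mul_I]
  rw [charFun_apply_real, translateMix, integral_finsetSum_measure fun i _ => hint i,
    Finset.sum_mul]
  refine Finset.sum_congr rfl fun i _ => ?_
  rw [integral_smul_measure, integral_map (by fun_prop) (by fun_prop), charFun_apply_real,
    ENNReal.toReal_ofReal (hc i), Complex.real_smul, mul_assoc,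
    ← integral_const_mul (Complex.exp _)]
  refine congrArg _ (integral_congr_ae (ae_of_all _ fun x => ?_))
  simp only [← Complex.exp_add]
  push_cast
  ring_nf

open Filter Topology in
/-- If a mixture of translates of a symmetric law is again symmetric, then the imaginary part of
the characteristic function of the mixing weights vanishes near the origin. -/
theorem eventually_sum_sin_eq_zero [IsProbabilityMeasure ν] (hsym : ν.map (fun x => -x) = ν)
    (hc : ∀ i, 0 ≤ c i)
    (h : ∀ x, ∑ i, c i * ν.real (Set.Iic (x - d i)) =
      ∑ i, c i * (1 - ν.real (Set.Iic (-x - d i)))) :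
    ∀ᶠ t in 𝓝 (0 : ℝ), ∑ i, c i * Real.sin (d i * t) = 0 := by
  have hIio (y : ℝ) : ν.real (Set.Iio y) = 1 - ν.real (Set.Iic (-y)) := by
    rw [← probReal_compl_eq_one_sub measurableSet_Iic, Set.compl_Iic]
    conv_lhs => rw [← hsym]
    rw [map_measureReal_apply (by fun_prop) measurableSet_Iio]
    congr 1
    ext z
    simp
  have hM : translateMix ν c d = translateMix ν c (-d) := by
    refine Measure.ext_of_Iic_eq_Iio fun x => ?_
    rw [translateMix_apply hc measurableSet_Iic, translateMix_apply hc measurableSet_Iio]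
    simp only [Pi.neg_apply, Set.preimage_add_const_Iic, Set.preimage_add_const_Iio, hIio, h]
    congr 1
    refine Finset.sum_congr rfl fun i _ => ?_
    ring_nf
  have hφ : ∀ᶠ t in 𝓝 (0 : ℝ), charFun ν t ≠ 0 :=
    continuous_charFun.continuousAt.eventually_ne (by simp)
  filter_upwards [hφ] with t ht
  have h1 := congrArg (fun M => charFun M t) hM
  simp only [charFun_translateMix hc] at h1
  have h2 := congrArg Complex.im (mul_right_cancel₀ ht h1)
  simp only [Complex.im_sum, Complex.im_ofReal_mul, Complex.exp_ofReal_mul_I_im, Pi.neg_apply,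
    neg_mul, Real.sin_neg, mul_neg, Finset.sum_neg_distrib] at h2
  linarith

end translateMix

section oddMoments

variable {ι : Type*} [Fintype ι] {c d : ι → ℝ}

open Filter Topology

theorem eventually_sum_cos_eq_zero_of_sin
    (h : ∀ᶠ t in 𝓝 (0 : ℝ), ∑ i, c i * Real.sin (d i * t) = 0) :
    ∀ᶠ t in 𝓝 (0 : ℝ), ∑ i, c i * d i * Real.cos (d i * t) = 0 := by
  filter_upwards [h.eventually_nhds] with t ht
  have hd : HasDerivAt (fun t => ∑ i, c i * Real.sin (d i * t))
      (∑ i, c i * d i * Real.cos (d i * t)) t := by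
    refine HasDerivAt.fun_sum fun i _ => ?_
    exact (((hasDerivAt_id' t).const_mul (d i)).sin.const_mul (c i)).congr_deriv (by ring)
  exact hd.unique ((hasDerivAt_const t (0 : ℝ)).congr_of_eventuallyEq ht)

theorem eventually_sum_sin_eq_zero_of_cos
    (h : ∀ᶠ t in 𝓝 (0 : ℝ), ∑ i, c i * Real.cos (d i * t) = 0) :
    ∀ᶠ t in 𝓝 (0 : ℝ), ∑ i, c i * d i * Real.sin (d i * t) = 0 := by
  filter_upwards [h.eventually_nhds] with t ht
  have hd : HasDerivAt (fun t => ∑ i, c i * Real.cos (d i * t))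
      (∑ i, -(c i * d i * Real.sin (d i * t))) t := by
    refine HasDerivAt.fun_sum fun i _ => ?_
    exact (((hasDerivAt_id' t).const_mul (d i)).cos.const_mul (c i)).congr_deriv (by ring)
  have := hd.unique ((hasDerivAt_const t (0 : ℝ)).congr_of_eventuallyEq ht)
  rwa [Finset.sum_neg_distrib, neg_eq_zero] at this

theorem sum_mul_odd_pow_eq_zero (k : ℕ) :
    ∀ {c : ι → ℝ}, (∀ᶠ t in 𝓝 (0 : ℝ), ∑ i, c i * Real.sin (d i * t) = 0) →
      ∑ i, c i * d i * (d i ^ 2) ^ k = 0 := by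
  induction k with
  | zero =>
    intro c h
    simpa using (eventually_sum_cos_eq_zero_of_sin h).self_of_nhds
  | succ k ih =>
    intro c h
    rw [← ih (eventually_sum_sin_eq_zero_of_cos (eventually_sum_cos_eq_zero_of_sin h))]
    exact Finset.sum_congr rfl fun i _ => by ring

/-- Linear independence of the sine functions, tested against arbitrary even weights. -/
theorem sum_mul_even_eq_zero
    (h : ∀ᶠ t in 𝓝 (0 : ℝ), ∑ i, c i * Real.sin (d i * t) = 0) (g : ℝ → ℝ) :
    ∑ i, c i * d i * g (d i ^ 2) = 0 := by
  classical
  have hpoly (p : Polynomial ℝ) : ∑ i, c i * d i * p.eval (d i ^ 2) = 0 := by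
    simp only [Polynomial.eval_eq_sum_range, Finset.mul_sum]
    rw [Finset.sum_comm]
    refine Finset.sum_eq_zero fun k _ => ?_
    rw [← mul_zero (p.coeff k), ← sum_mul_odd_pow_eq_zero k h, Finset.mul_sum]
    exact Finset.sum_congr rfl fun i _ => by ring
  rw [← hpoly (Lagrange.interpolate (Finset.univ.image fun i => d i ^ 2) id g)]
  refine Finset.sum_congr rfl fun i _ => ?_
  congr 1
  exact (Lagrange.eval_interpolate_at_node g (v := id) (Set.injOn_id _)
    (Finset.mem_image_of_mem (fun i => d i ^ 2) (Finset.mem_univ i))).symm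

end oddMoments

/-- `Ainv` is a right inverse of `Aop` on bounded functions. -/
theorem Aop_Ainv {lam mu₁ mu₂ : ℝ} (hlam : lam ∈ Set.Ico (0 : ℝ) (1 / 2)) {H : ℝ → ℝ} {C : ℝ}
    (hH : ∀ x, |H x| ≤ C) (x : ℝ) : Aop lam mu₁ mu₂ (Ainv lam mu₁ mu₂ H) x = H x := by
  obtain ⟨h0, h1⟩ := hlam
  have hpos : 0 < 1 - lam := by linarith
  set r : ℝ := -lam / (1 - lam) with hr
  have hr1 : |r| < 1 := by
    rw [hr, abs_div, abs_neg, abs_of_nonneg h0, abs_of_pos hpos, div_lt_one hpos]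
    linarith
  have hs : Summable fun k : ℕ => r ^ k * H (x + k * (mu₂ - mu₁)) := by
    refine Summable.of_norm_bounded
      ((summable_geometric_of_lt_one (abs_nonneg r) hr1).mul_right C) fun k => ?_
    rw [Real.norm_eq_abs, abs_mul, abs_pow]
    exact mul_le_mul_of_nonneg_left (hH _) (by positivity)
  have h2 : Ainv lam mu₁ mu₂ H (x - mu₂) =
      1 / (1 - lam) * ∑' k : ℕ, r ^ k * H (x + k * (mu₂ - mu₁)) := by
    simp only [Ainv, sub_add_cancel, ← hr]
  have h3 : lam * Ainv lam mu₁ mu₂ H (x - mu₁) =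
      -∑' k : ℕ, r ^ (k + 1) * H (x + (k + 1 : ℕ) * (mu₂ - mu₁)) := by
    rw [Ainv, ← hr, ← mul_assoc, ← tsum_mul_left, ← tsum_neg]
    refine tsum_congr fun k => ?_
    have harg : x - mu₁ + mu₂ + k * (mu₂ - mu₁) = x + (k + 1 : ℕ) * (mu₂ - mu₁) := by
      push_cast; ring
    rw [harg, pow_succ, hr]
    ring
  rw [Aop, h2, h3, hs.tsum_eq_zero_add, ← mul_assoc, mul_one_div_cancel hpos.ne']
  simp

/-- The symmetry equation, cleared of the inverse operator. -/
theorem Aop_Sr_eq_of_fixed {lam mu₁ mu₂ : ℝ} (hlam : lam ∈ Set.Ico (0 : ℝ) (1 / 2))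
    {G : ℝ → ℝ} {C : ℝ} (hG : ∀ x, |G x| ≤ C)
    (heq : ∀ x : ℝ, Aop lam mu₁ mu₂ (Sr (Ainv lam mu₁ mu₂ G)) x = G x) (x : ℝ) :
    Aop lam mu₁ mu₂ (Sr G) x = Aop lam (-mu₁) (-mu₂) G x := by
  have hA := Aop_Ainv (mu₁ := mu₁) (mu₂ := mu₂) hlam hG
  simp only [Aop, Sr] at heq hA ⊢
  rw [← heq (x - -mu₁), ← heq (x - -mu₂), ← hA (-(x - mu₁)), ← hA (-(x - mu₂))]
  ring_nf

/-- The coefficient of `sin (t * ·)` in `sin (s * ·)`. -/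
noncomputable def signMatch (s t : ℝ) : ℝ := if s = t then 1 else if s = -t then -1 else 0

theorem mul_indicator_sq_eq (s t : ℝ) :
    s * (if s ^ 2 = t ^ 2 then 1 else 0) = signMatch s t * t := by
  simp only [sq_eq_sq_iff_eq_or_eq_neg, signMatch]
  split_ifs <;> simp_all

theorem signMatch_self (t : ℝ) : signMatch t t = 1 := if_pos rfl

theorem signMatch_eq_zero {s t : ℝ} (h : s ≠ t) (h' : s ≠ -t) : signMatch s t = 0 := by
  simp [signMatch, h, h']

theorem signMatch_of_eq_neg {s t : ℝ} (ht : t ≠ 0) (h : s = -t) : signMatch s t = -1 := by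
  simp [signMatch, h, neg_eq_self, ht]

theorem neg_one_le_signMatch (s t : ℝ) : -1 ≤ signMatch s t := by
  unfold signMatch
  split_ifs <;> norm_num

theorem signMatch_nonneg {s t : ℝ} (h : s ≠ -t) : 0 ≤ signMatch s t := by
  simp only [signMatch, if_neg h]
  split_ifs <;> norm_num

theorem signMatch_nonpos {s t : ℝ} (h : s ≠ t) : signMatch s t ≤ 0 := by
  simp only [signMatch, if_neg h]
  split_ifs <;> norm_num

/-- Two two-point laws with majority weight on the second point are determined, up to a first
point of weight zero, by the real-valuedness of the product of their characters. -/
theorem two_point_identifiable {l l₀ a b m₁ m₂ : ℝ}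
    (hl₀ : l₀ ∈ Set.Ico (0 : ℝ) (1 / 2)) (hab : a ≠ b)
    (hl : l ∈ Set.Ico (0 : ℝ) (1 / 2)) (hm : m₁ ≠ m₂)
    (h : ∀ g : ℝ → ℝ, l₀ * l * (a - m₁) * g ((a - m₁) ^ 2) +
      l₀ * (1 - l) * (a - m₂) * g ((a - m₂) ^ 2) +
      (1 - l₀) * l * (b - m₁) * g ((b - m₁) ^ 2) +
      (1 - l₀) * (1 - l) * (b - m₂) * g ((b - m₂) ^ 2) = 0) :
    l = l₀ ∧ m₂ = b ∧ (0 < l₀ → m₁ = a) := by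
  obtain ⟨h1, h2⟩ := hl₀
  obtain ⟨h3, h4⟩ := hl
  have hcoef (t : ℝ) (ht : t ≠ 0) :
      l₀ * l * signMatch (a - m₁) t + l₀ * (1 - l) * signMatch (a - m₂) t +
      (1 - l₀) * l * signMatch (b - m₁) t + (1 - l₀) * (1 - l) * signMatch (b - m₂) t = 0 := by
    have := h fun s => if s = t ^ 2 then 1 else 0
    simp only [mul_assoc, mul_indicator_sq_eq] at this
    refine (mul_eq_zero.1 ?_).resolve_right ht
    rw [← this]
    ring
  clear h
  have p1 : 0 ≤ l₀ * l := mul_nonneg h1 h3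
  have p2 : 0 ≤ l₀ * (1 - l) := mul_nonneg h1 (by linarith)
  have p3 : 0 ≤ (1 - l₀) * l := mul_nonneg (by linarith) h3
  have p4 : 0 < (1 - l₀) * (1 - l) := mul_pos (by linarith) (by linarith)
  have p5 : 0 < (1 - 2 * l₀) * (1 - l) := mul_pos (by linarith) (by linarith)
  have p6 : 0 < (1 - l₀) * (1 - 2 * l) := mul_pos (by linarith) (by linarith)
  have hw : b = m₂ := by
    by_contra hne
    have hw : b - m₂ ≠ 0 := sub_ne_zero.2 hne
    have e := hcoef _ hw
    rw [signMatch_self] at e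
    have ey : signMatch (a - m₂) (b - m₂) ≤ 0 ∧ -1 ≤ signMatch (a - m₂) (b - m₂) :=
      ⟨signMatch_nonpos fun h => hab (by linarith), neg_one_le_signMatch _ _⟩
    have ez : signMatch (b - m₁) (b - m₂) ≤ 0 ∧ -1 ≤ signMatch (b - m₁) (b - m₂) :=
      ⟨signMatch_nonpos fun h => hm (by linarith), neg_one_le_signMatch _ _⟩
    by_cases hy : a - m₂ = -(b - m₂)
    · by_cases hz : b - m₁ = -(b - m₂)
      · have hx : a - m₁ ≠ 0 := fun hx => hw (by linarith)
        have e' := hcoef _ hx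
        rw [signMatch_self, signMatch_eq_zero, signMatch_eq_zero, signMatch_eq_zero] at e' <;>
          try exact fun h => hw (by linarith)
        have e0 : l₀ * l = 0 := by linarith
        rw [e0] at e
        nlinarith [mul_le_mul_of_nonneg_left ey.2 p2, mul_le_mul_of_nonneg_left ez.2 p3]
      · have hz' := signMatch_nonneg hz
        have hx := signMatch_nonneg (s := a - m₁) (t := b - m₂) fun h => hm (by linarith)
        nlinarith [mul_le_mul_of_nonneg_left ey.2 p2, mul_nonneg p3 hz', mul_nonneg p1 hx]
    · have hy' := mul_nonneg p2 (signMatch_nonneg hy)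
      by_cases hz : b - m₁ = -(b - m₂)
      · have hx := signMatch_nonneg (s := a - m₁) (t := b - m₂) fun h => hab (by linarith)
        nlinarith [mul_le_mul_of_nonneg_left ez.2 p3, mul_nonneg p1 hx]
      · nlinarith [mul_nonneg p3 (signMatch_nonneg hz),
          mul_le_mul_of_nonneg_left (neg_one_le_signMatch (a - m₁) (b - m₂)) p1]
  subst hw
  have hp : a - b ≠ 0 := sub_ne_zero.2 hab
  have hq : b - m₁ ≠ 0 := sub_ne_zero.2 hm.symm
  have e := hcoef _ hp
  rw [signMatch_self, sub_self, signMatch_eq_zero (s := 0) hp.symm (neg_ne_zero.2 hp).symm] at e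
  by_cases hpq : a = m₁
  · subst hpq
    rw [sub_self, signMatch_eq_zero (s := 0) hp.symm (neg_ne_zero.2 hp).symm,
      signMatch_of_eq_neg hp (neg_sub a b).symm] at e
    exact ⟨by linarith, rfl, fun _ => rfl⟩
  · have hz := signMatch_nonneg (s := b - m₁) (t := a - b) fun h => hpq (by linarith)
    have hl0 : l₀ = 0 := by
      nlinarith [mul_nonneg p3 hz,
        mul_le_mul_of_nonneg_left (neg_one_le_signMatch (a - m₁) (a - b)) p1]
    have e' := hcoef _ hq
    rw [signMatch_self, sub_self, hl0,
      signMatch_eq_zero (s := 0) hq.symm (neg_ne_zero.2 hq).symm] at e'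
    exact ⟨by linarith, rfl, fun h => absurd hl0 h.ne'⟩

/-- If `G = A_{θ₀} F₀` with `F₀` a symmetric cdf and `A_θ S_r A_θ⁻¹ G = G`, then
`θ` coincides with `θ₀` (up to the degenerate first component when `λ₀ = 0`). -/
theorem stmt_12
    (ν : Measure ℝ) (hprob : IsProbabilityMeasure ν) (hsym : ν.map (fun x => -x) = ν)
    (F₀ : ℝ → ℝ) (hF₀ : ∀ x : ℝ, F₀ x = (ν (Set.Iic x)).toReal)
    (lam₀ mu₁₀ mu₂₀ : ℝ) (hlam₀ : lam₀ ∈ Set.Ico (0 : ℝ) (1 / 2)) (hmu₀ : mu₁₀ ≠ mu₂₀)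
    (G : ℝ → ℝ) (hG : ∀ x : ℝ, G x = Aop lam₀ mu₁₀ mu₂₀ F₀ x)
    (lam mu₁ mu₂ : ℝ) (hlam : lam ∈ Set.Ico (0 : ℝ) (1 / 2)) (hmu : mu₁ ≠ mu₂)
    (heq : ∀ x : ℝ, Aop lam mu₁ mu₂ (Sr (Ainv lam mu₁ mu₂ G)) x = G x) :
    lam = lam₀ ∧ mu₂ = mu₂₀ ∧ (0 < lam₀ → mu₁ = mu₁₀) := by
  have hF (x : ℝ) : F₀ x = ν.real (Set.Iic x) := hF₀ x
  have hGb (x : ℝ) : |G x| ≤ 1 := by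
    have h1 (y : ℝ) : 0 ≤ F₀ y := hF y ▸ measureReal_nonneg
    have h2 (y : ℝ) : F₀ y ≤ 1 := hF y ▸ measureReal_le_one
    obtain ⟨h3, h4⟩ := hlam₀
    rw [hG, Aop, abs_le]
    constructor <;> nlinarith [h1 (x - mu₁₀), h1 (x - mu₂₀), h2 (x - mu₁₀), h2 (x - mu₂₀)]
  have hkey := Aop_Sr_eq_of_fixed hlam hGb heq
  let c : Fin 4 → ℝ := ![lam₀ * lam, lam₀ * (1 - lam), (1 - lam₀) * lam, (1 - lam₀) * (1 - lam)]
  let d : Fin 4 → ℝ := ![mu₁₀ - mu₁, mu₁₀ - mu₂, mu₂₀ - mu₁, mu₂₀ - mu₂]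
  have hc (i : Fin 4) : 0 ≤ c i := by
    have h1 := hlam.1
    have h2 := hlam₀.1
    have h3 : 0 ≤ 1 - lam := by linarith [hlam.2]
    have h4 : 0 ≤ 1 - lam₀ := by linarith [hlam₀.2]
    fin_cases i <;> simp [c] <;> positivity
  have hsin := eventually_sum_sin_eq_zero (ν := ν) (c := c) (d := d) hsym hc fun x => by
    have := hkey x
    simp only [Aop, Sr, hG, hF] at this
    simp only [Fin.sum_univ_four, c, d, Matrix.cons_val]
    ring_nf at this ⊢
    linarith
  refine two_point_identifiable hlam₀ hmu₀ hlam hmu fun g => ?_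
  simpa [Fin.sum_univ_four, c, d] using sum_mul_even_eq_zero hsin g
end

section
/- Assume condition C2 and that θ₀ is an interior point of Θ. Then there exist η > 0 and α > 0 such that for every u ∈ ℝ³ with |u|₂ < η and θ₀ + u ∈ Θ, one has K(θ₀ + u) ≥ α |u|₂². (Local quadratic lower bound for the contrast function at the true parameter.) -/
open MeasureTheory

/-- Euclidean norm on `ℝ³ = ℝ × ℝ × ℝ`. -/
noncomputable def enorm3 (θ : ℝ × ℝ × ℝ) : ℝ :=
  Real.sqrt (θ.1 ^ 2 + θ.2.1 ^ 2 + θ.2.2 ^ 2)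

open Filter Topology

lemma summable_neg_pow_mul {q : ℝ} (hq₀ : 0 ≤ q) (hq₁ : q < 1) {g : ℕ → ℝ} {C : ℝ}
    (hg : ∀ k, |g k| ≤ C) : Summable fun k => (-q) ^ k * g k := by
  refine Summable.of_norm_bounded (g := fun k => q ^ k * C)
    ((summable_geometric_of_lt_one hq₀ hq₁).mul_right C) fun k => ?_
  rw [norm_mul, norm_pow, norm_neg, Real.norm_of_nonneg hq₀]
  exact mul_le_mul_of_nonneg_left (hg k) (by positivity)

/-- An alternating geometric series telescopes against a bounded sequence. -/
lemma hasSum_neg_pow_mul_add {q : ℝ} (hq₀ : 0 ≤ q) (hq₁ : q < 1) {g : ℕ → ℝ} {C : ℝ}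
    (hg : ∀ k, |g k| ≤ C) :
    HasSum (fun k => (-q) ^ k * (g k + q * g (k + 1))) (g 0) := by
  have h0 := (summable_neg_pow_mul hq₀ hq₁ hg).hasSum
  have h1 := (hasSum_nat_add_iff' 1).2 h0
  have h2 := h0.sub h1
  simp only [Finset.sum_range_one, pow_zero, one_mul, sub_sub_cancel] at h2
  refine h2.congr_fun fun k => ?_
  ring

lemma bounded_of_integrable_deriv {f : ℝ → ℝ} (hf : ContDiff ℝ 1 f)
    (hi : Integrable (deriv f)) : ∃ M, ∀ x, |f x| ≤ M := by
  refine ⟨|f 0| + ∫ x, ‖deriv f x‖, fun x => ?_⟩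
  have h1 : ∫ y in (0 : ℝ)..x, deriv f y = f x - f 0 :=
    intervalIntegral.integral_deriv_eq_sub
      (fun y _ => (hf.differentiable (by norm_num)).differentiableAt) hi.intervalIntegrable
  have h2 : ‖∫ y in (0 : ℝ)..x, deriv f y‖ ≤ ∫ x, ‖deriv f x‖ :=
    intervalIntegral.norm_integral_le_integral_norm_uIoc.trans
      (setIntegral_le_integral hi.norm (ae_of_all _ fun _ => norm_nonneg _))
  rw [h1, Real.norm_eq_abs] at h2
  have h3 := abs_add_le (f 0) (f x - f 0)
  rw [add_sub_cancel] at h3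
  linarith

lemma abs_sub_le_of_abs_deriv_le {F : ℝ → ℝ} (hF : Differentiable ℝ F) {M : ℝ}
    (hM : ∀ x, |deriv F x| ≤ M) (p q : ℝ) : |F p - F q| ≤ M * |p - q| :=
  convex_univ.norm_image_sub_le_of_norm_deriv_le (fun x _ => hF x) (fun x _ => hM x)
    (Set.mem_univ q) (Set.mem_univ p)

lemma tendsto_sub_div_of_hasStrictDerivAt {ι : Type*} {l : Filter ι} {F : ℝ → ℝ} {F' p c : ℝ}
    (hF : HasStrictDerivAt F F' p) {a b r : ι → ℝ} (ha : Tendsto a l (𝓝 p))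
    (hb : Tendsto b l (𝓝 p)) (hr : ∀ i, r i ≠ 0)
    (hab : Tendsto (fun i => (a i - b i) / r i) l (𝓝 c)) :
    Tendsto (fun i => (F (a i) - F (b i)) / r i) l (𝓝 (F' * c)) := by
  have h1 := hF.isLittleO.comp_tendsto (ha.prodMk_nhds hb)
  have h2 : (fun i => a i - b i) =O[l] r := by
    have := (hab.isBigO_one ℝ).mul (Asymptotics.isBigO_refl r l)
    refine this.congr (fun i => ?_) (fun i => one_mul _)
    rw [div_mul_cancel₀ _ (hr i)]
  have h3 := (h1.trans_isBigO h2).tendsto_div_nhds_zero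
  have h4 := h3.add (hab.const_mul F')
  rw [zero_add] at h4
  refine h4.congr fun i => ?_
  simp only [Function.comp, ContinuousLinearMap.toSpanSingleton_apply, smul_eq_mul]
  ring

/-- The Fourier transform of an integrable density rules out a nontrivial relation between the
density, the sum of its two translates by `±η`, and the corresponding increment of its primitive. -/
lemma eq_zero_of_increment_eq {F f : ℝ → ℝ} (hF : ∀ x, HasDerivAt F (f x) x)
    (hf : Integrable f) (hf₁ : ∫ x, f x ≠ 0) {η a b c : ℝ} (hη : η ≠ 0)
    (h : ∀ x, a * (F (x + η) - F (x - η)) = b * f x + c * (f (x + η) + f (x - η))) :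
    a = 0 ∧ b = 0 ∧ c = 0 := by
  have hmulcos : ∀ (g : ℝ → ℝ) (t : ℝ), Integrable g → Integrable fun x => g x * Real.cos (t * x) :=
    fun g t hg => hg.mul_bdd (c := 1) (by fun_prop) (ae_of_all _ fun x => Real.abs_cos_le_one _)
  have hmulsin : ∀ (g : ℝ → ℝ) (t : ℝ), Integrable g → Integrable fun x => g x * Real.sin (t * x) :=
    fun g t hg => hg.mul_bdd (c := 1) (by fun_prop) (ae_of_all _ fun x => Real.abs_sin_le_one _)
  set J : ℝ → ℝ := fun t => ∫ x, f x * Real.cos (t * x) with hJ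
  set S : ℝ → ℝ := fun t => ∫ x, f x * Real.sin (t * x) with hS
  have hfp : Integrable fun x => f (x + η) := hf.comp_add_right η
  have hfm : Integrable fun x => f (x - η) := hf.comp_sub_right η
  have hcos : ∀ s t, ∫ x, f (x + s) * Real.cos (t * x) =
      Real.cos (t * s) * J t + Real.sin (t * s) * S t := by
    intro s t
    have := integral_add_right_eq_self (μ := volume)
      (fun y => f y * Real.cos (t * (y - s))) s
    simp only [add_sub_cancel_right] at this
    rw [this, hJ, hS]
    simp only
    rw [← integral_const_mul, ← integral_const_mul,
      ← integral_add ((hmulcos f t hf).const_mul _) ((hmulsin f t hf).const_mul _)]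
    congr 1 with y
    rw [mul_sub, Real.cos_sub]; ring
  have hsin : ∀ s t, ∫ x, f (x + s) * Real.sin (t * x) =
      Real.cos (t * s) * S t - Real.sin (t * s) * J t := by
    intro s t
    have := integral_add_right_eq_self (μ := volume)
      (fun y => f y * Real.sin (t * (y - s))) s
    simp only [add_sub_cancel_right] at this
    rw [this, hJ, hS]
    simp only
    rw [← integral_const_mul, ← integral_const_mul,
      ← integral_sub ((hmulsin f t hf).const_mul _) ((hmulcos f t hf).const_mul _)]
    congr 1 with y
    rw [mul_sub, Real.sin_sub]; ring
  have hrel : ∀ t, J t * (2 * a * Real.sin (t * η)) =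
      J t * (t * (b + 2 * c * Real.cos (t * η))) := by
    intro t
    set E : ℝ → ℝ := fun x => a * (F (x + η) - F (x - η)) with hE
    have hEint : Integrable E := by
      have : E = fun x => b * f x + c * (f (x + η) + f (x - η)) := funext h
      rw [this]
      exact (hf.const_mul b).add ((hfp.add hfm).const_mul c)
    have hEd : ∀ x, HasDerivAt E (a * (f (x + η) - f (x - η))) x := fun x =>
      ((((hF (x + η)).comp_add_const x η)).sub ((hF (x - η)).comp_sub_const x η)).const_mul a
    have hEd_int : Integrable fun x => a * (f (x + η) - f (x - η)) := (hfp.sub hfm).const_mul a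
    have hparts := integral_mul_deriv_eq_deriv_mul_of_integrable (u := E)
      (v := fun x => Real.sin (t * x)) (u' := fun x => a * (f (x + η) - f (x - η)))
      (v' := fun x => t * Real.cos (t * x)) (fun x _ => hEd x)
      (fun x _ => by
        have := ((hasDerivAt_id x).const_mul t).sin
        simpa [mul_comm] using this)
      (by
        have := (hmulcos E t hEint).const_mul t
        refine this.congr (ae_of_all _ fun x => ?_)
        simp only [Pi.mul_apply]; ring)
      (hmulsin _ t hEd_int) (hmulsin _ t hEint)
    have h1 : ∫ x, E x * (t * Real.cos (t * x)) = t * (b * J t + c * (2 * Real.cos (t * η) * J t)) := by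
      have e1 := hcos η t
      have e2 := hcos (-η) t
      simp only [← sub_eq_add_neg, mul_neg, Real.cos_neg, Real.sin_neg] at e2
      have : ∀ x, E x * (t * Real.cos (t * x)) = t * (b * (f x * Real.cos (t * x)) +
          c * (f (x + η) * Real.cos (t * x) + f (x - η) * Real.cos (t * x))) := by
        intro x
        rw [hE]; simp only; rw [h x]; ring
      simp_rw [this]
      have hsum : Integrable fun x => c * (f (x + η) * Real.cos (t * x) +
          f (x - η) * Real.cos (t * x)) := ((hmulcos _ t hfp).add (hmulcos _ t hfm)).const_mul c
      rw [integral_const_mul, integral_add ((hmulcos f t hf).const_mul b) hsum, integral_const_mul,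
        integral_const_mul, integral_add (hmulcos _ t hfp) (hmulcos _ t hfm), e1, e2]
      simp only [hJ]
      ring
    have h2 : ∫ x, (a * (f (x + η) - f (x - η))) * Real.sin (t * x) =
        a * (-2 * Real.sin (t * η) * J t) := by
      have e1 := hsin η t
      have e2 := hsin (-η) t
      simp only [← sub_eq_add_neg, mul_neg, Real.cos_neg, Real.sin_neg] at e2
      have : ∀ x, (a * (f (x + η) - f (x - η))) * Real.sin (t * x) =
          a * (f (x + η) * Real.sin (t * x) - f (x - η) * Real.sin (t * x)) := by
        intro x; ring
      simp_rw [this]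
      rw [integral_const_mul, integral_sub (hmulsin _ t hfp) (hmulsin _ t hfm), e1, e2]
      ring
    rw [h1, h2] at hparts
    linarith
  have hJc : Continuous J := by
    refine continuous_of_dominated (bound := fun x => ‖f x‖) (fun t => (hmulcos f t hf).1)
      (fun t => ae_of_all _ fun x => ?_) hf.norm (ae_of_all _ fun x => by fun_prop)
    rw [norm_mul]
    exact mul_le_of_le_one_right (norm_nonneg _) (Real.abs_cos_le_one _)
  have hJ0 : J 0 ≠ 0 := by simpa [hJ] using hf₁
  have hev : (fun t => 2 * a * Real.sin (t * η)) =ᶠ[𝓝 0]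
      fun t => t * (b + 2 * c * Real.cos (t * η)) := by
    filter_upwards [hJc.continuousAt.eventually_ne hJ0] with t ht
    exact mul_left_cancel₀ ht (hrel t)
  have han1 : AnalyticOnNhd ℝ (fun t => 2 * a * Real.sin (t * η)) Set.univ := fun t _ => by
    fun_prop
  have han2 : AnalyticOnNhd ℝ (fun t => t * (b + 2 * c * Real.cos (t * η))) Set.univ :=
    fun t _ => by fun_prop
  have heq := han1.eq_of_eventuallyEq han2 hev
  have e1 := congrFun heq (Real.pi / η)
  have e2 := congrFun heq (2 * Real.pi / η)
  have e3 := congrFun heq (Real.pi / 2 / η)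
  simp only [div_mul_cancel₀ _ hη, Real.sin_pi, Real.sin_two_pi, Real.cos_pi, Real.cos_two_pi,
    Real.sin_pi_div_two, Real.cos_pi_div_two] at e1 e2 e3
  have hpi := Real.pi_ne_zero
  simp only [mul_zero, zero_eq_mul, mul_one, mul_neg, div_eq_zero_iff, mul_eq_zero, hη, hpi,
    OfNat.ofNat_ne_zero, or_self, false_or] at e1 e2
  have hb : b = 0 := by linarith
  have hc : c = 0 := by linarith
  subst hb hc
  exact ⟨by simpa using e3, rfl, rfl⟩

lemma Sr_Ainv_eq_tsum {l m₁ m₂ : ℝ} (hl₀ : 0 ≤ l) (hl₁ : l < 1 / 2) {G Gr : ℝ → ℝ}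
    (hGr : ∀ x, |Gr x| ≤ 1) (hrefl : ∀ x, G (-x) = 1 - Gr x) (x : ℝ) :
    Sr (Ainv l m₁ m₂ G) x =
      1 / (1 - l) * ∑' k : ℕ, (-(l / (1 - l))) ^ k * Gr (x - m₂ - k * (m₂ - m₁)) := by
  have h1 : 0 < 1 - l := by linarith
  have hq₀ : 0 ≤ l / (1 - l) := by positivity
  have hq₁ : l / (1 - l) < 1 := by rw [div_lt_one h1]; linarith
  have hs := summable_neg_pow_mul hq₀ hq₁ (g := fun k : ℕ => Gr (x - m₂ - k * (m₂ - m₁)))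
    (fun k => hGr _)
  have hgeo : |-(l / (1 - l))| < 1 := by rwa [abs_neg, abs_of_nonneg hq₀]
  have hterm : ∀ k : ℕ, (-l / (1 - l)) ^ k * G (-x + m₂ + k * (m₂ - m₁)) =
      (-(l / (1 - l))) ^ k - (-(l / (1 - l))) ^ k * Gr (x - m₂ - k * (m₂ - m₁)) := fun k => by
    rw [show -x + m₂ + (k : ℝ) * (m₂ - m₁) = -(x - m₂ - k * (m₂ - m₁)) by ring, hrefl, neg_div]
    ring
  unfold Sr Ainv
  simp_rw [hterm]
  rw [(summable_geometric_of_abs_lt_one hgeo).tsum_sub hs, tsum_geometric_of_abs_lt_one hgeo,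
    mul_sub, sub_neg_eq_add, show 1 / (1 - l) * (1 + l / (1 - l))⁻¹ = 1 by field_simp; ring]
  ring

lemma Aop_Sr_Ainv_sub {l m₁ m₂ : ℝ} (hl₀ : 0 ≤ l) (hl₁ : l < 1 / 2) {G Gr : ℝ → ℝ}
    (hG : ∀ x, |G x| ≤ 1) (hGr : ∀ x, |Gr x| ≤ 1) (hrefl : ∀ x, G (-x) = 1 - Gr x) (x : ℝ) :
    Aop l m₁ m₂ (Sr (Ainv l m₁ m₂ G)) x - G x =
      1 / (1 - l) * ∑' k : ℕ, (-(l / (1 - l))) ^ k *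
        (Aop l m₁ m₂ Gr (x - m₂ - k * (m₂ - m₁)) -
          Aop l (-m₁) (-m₂) G (x - m₂ - k * (m₂ - m₁))) := by
  have h1 : 0 < 1 - l := by linarith
  have hq₀ : 0 ≤ l / (1 - l) := by positivity
  have hq₁ : l / (1 - l) < 1 := by rw [div_lt_one h1]; linarith
  have hA : HasSum (fun k : ℕ => (-(l / (1 - l))) ^ k *
      Aop l m₁ m₂ Gr (x - m₂ - k * (m₂ - m₁)))
      ((1 - l) * Aop l m₁ m₂ (Sr (Ainv l m₁ m₂ G)) x) := by
    have e1 := (summable_neg_pow_mul hq₀ hq₁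
      (g := fun k : ℕ => Gr (x - m₁ - m₂ - k * (m₂ - m₁))) (fun k => hGr _)).hasSum.mul_left l
    have e2 := (summable_neg_pow_mul hq₀ hq₁
      (g := fun k : ℕ => Gr (x - m₂ - m₂ - k * (m₂ - m₁))) (fun k => hGr _)).hasSum.mul_left (1 - l)
    have ev : (1 - l) * Aop l m₁ m₂ (Sr (Ainv l m₁ m₂ G)) x =
        l * ∑' k : ℕ, (-(l / (1 - l))) ^ k * Gr (x - m₁ - m₂ - k * (m₂ - m₁)) +
          (1 - l) * ∑' k : ℕ, (-(l / (1 - l))) ^ k * Gr (x - m₂ - m₂ - k * (m₂ - m₁)) := by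
      simp only [Aop, Sr_Ainv_eq_tsum hl₀ hl₁ hGr hrefl]
      generalize ∑' k : ℕ, (-(l / (1 - l))) ^ k * Gr (x - m₁ - m₂ - k * (m₂ - m₁)) = s
      generalize ∑' k : ℕ, (-(l / (1 - l))) ^ k * Gr (x - m₂ - m₂ - k * (m₂ - m₁)) = t
      field_simp
    rw [ev]
    refine (e1.add e2).congr_fun fun k => ?_
    simp only [Aop]
    rw [show x - m₂ - (k : ℝ) * (m₂ - m₁) - m₁ = x - m₁ - m₂ - k * (m₂ - m₁) by ring,
      show x - m₂ - (k : ℝ) * (m₂ - m₁) - m₂ = x - m₂ - m₂ - k * (m₂ - m₁) by ring]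
    ring
  have hB : HasSum (fun k : ℕ => (-(l / (1 - l))) ^ k *
      Aop l (-m₁) (-m₂) G (x - m₂ - k * (m₂ - m₁))) ((1 - l) * G x) := by
    have e := (hasSum_neg_pow_mul_add hq₀ hq₁
      (g := fun k : ℕ => G (x - k * (m₂ - m₁))) (fun k => hG _)).mul_left (1 - l)
    simp only [Nat.cast_zero, zero_mul, sub_zero] at e
    refine e.congr_fun fun k => ?_
    simp only [Aop, Nat.cast_add, Nat.cast_one]
    rw [show x - m₂ - (k : ℝ) * (m₂ - m₁) - -m₁ = x - (k + 1) * (m₂ - m₁) by ring,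
      show x - m₂ - (k : ℝ) * (m₂ - m₁) - -m₂ = x - k * (m₂ - m₁) by ring]
    field_simp
    ring
  have hAB := (hA.sub hB).tsum_eq
  simp only [← mul_sub] at hAB
  rw [hAB]
  field_simp

/-- The defect `(A_θ Ā_θ₀ - Ā_θ A_θ₀) F` at `θ = θ₀ + (a, b, c)`, where `Ā` is the mixing operator
with reflected locations, arranged in increments of `F` that vanish at `θ = θ₀`. -/
noncomputable def mixDefect (F : ℝ → ℝ) (l η a b c y : ℝ) : ℝ :=
  (l + a) * l * (F (y - b) - F (y + b))
    + (l + a) * (1 - l) * ((F (y + η - b) - F (y + η)) - (F (y - η + b) - F (y - η)))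
    + (1 - (l + a)) * l * ((F (y - η - c) - F (y - η)) - (F (y + η + c) - F (y + η)))
    + (1 - (l + a)) * (1 - l) * (F (y - c) - F (y + c))
    + a * (F (y + η) - F (y - η))

/-- The derivative of `mixDefect` at `(a, b, c) = 0` in the direction `(α, β, γ)`. -/
noncomputable def mixDefectDeriv (F : ℝ → ℝ) (l η α β γ y : ℝ) : ℝ :=
  l * l * (deriv F y * -(2 * β))
    + l * (1 - l) * (deriv F (y + η) * -β - deriv F (y - η) * β)
    + (1 - l) * l * (deriv F (y - η) * -γ - deriv F (y + η) * γ)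
    + (1 - l) * (1 - l) * (deriv F y * -(2 * γ))
    + α * (F (y + η) - F (y - η))

lemma Aop_sub_Aop_eq_mixDefect (F : ℝ → ℝ) (l m₁ m₂ a b c y : ℝ) :
    Aop (l + a) (m₁ + b) (m₂ + c) (Aop l (-m₁) (-m₂) F) y -
      Aop (l + a) (-(m₁ + b)) (-(m₂ + c)) (Aop l m₁ m₂ F) y =
        mixDefect F l (m₂ - m₁) a b c y := by
  simp only [Aop, mixDefect]
  ring_nf

lemma abs_mixDefect_le {F : ℝ → ℝ} {M : ℝ} (hM : 0 ≤ M)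
    (hLip : ∀ p q, |F p - F q| ≤ M * |p - q|) (hosc : ∀ p q, |F p - F q| ≤ 1)
    {l a b c r : ℝ} (hl₀ : 0 ≤ l) (hl₁ : l ≤ 1) (hla₀ : 0 ≤ l + a) (hla₁ : l + a ≤ 1)
    (ha : |a| ≤ r) (hb : |b| ≤ r) (hc : |c| ≤ r) (η y : ℝ) :
    |mixDefect F l η a b c y| ≤ (8 * M + 1) * r := by
  have hr : 0 ≤ r := (abs_nonneg a).trans ha
  have hMr : 0 ≤ M * r := by positivity
  have key : ∀ p q t k, |t| ≤ r → 0 ≤ k → |p - q| = k * |t| → |F p - F q| ≤ k * (M * r) := by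
    intro p q t k ht hk h
    refine (hLip p q).trans ?_
    rw [h, mul_left_comm]
    gcongr
  have w : ∀ s t z : ℝ, 0 ≤ s → s ≤ 1 → 0 ≤ t → t ≤ 1 → |z| ≤ 2 * (M * r) →
      |s * t * z| ≤ 2 * (M * r) := by
    intro s t z hs₀ hs₁ ht₀ ht₁ hz
    rw [abs_mul, abs_of_nonneg (mul_nonneg hs₀ ht₀)]
    exact (mul_le_of_le_one_left (abs_nonneg z) (mul_le_one₀ hs₁ ht₀ ht₁)).trans hz
  have e1 := w _ _ _ hla₀ hla₁ hl₀ hl₁ (key (y - b) (y + b) b 2 hb (by norm_num)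
    (by rw [show y - b - (y + b) = -(2 * b) by ring, abs_neg, abs_mul, abs_two]))
  have e2 := w _ (1 - l) _ hla₀ hla₁ (by linarith) (by linarith) <| (abs_sub _ _).trans
    (add_le_add (key (y + η - b) (y + η) b 1 hb (by norm_num) (by simp))
      (key (y - η + b) (y - η) b 1 hb (by norm_num) (by simp)) |>.trans (by linarith))
  have e3 := w (1 - (l + a)) l _ (by linarith) (by linarith) hl₀ hl₁ <| (abs_sub _ _).trans
    (add_le_add (key (y - η - c) (y - η) c 1 hc (by norm_num) (by simp))
      (key (y + η + c) (y + η) c 1 hc (by norm_num) (by simp)) |>.trans (by linarith))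
  have e4 := w (1 - (l + a)) (1 - l) _ (by linarith) (by linarith) (by linarith) (by linarith)
    (key (y - c) (y + c) c 2 hc (by norm_num)
      (by rw [show y - c - (y + c) = -(2 * c) by ring, abs_neg, abs_mul, abs_two]))
  have e5 : |a * (F (y + η) - F (y - η))| ≤ r := by
    rw [abs_mul]
    exact (mul_le_of_le_one_right (abs_nonneg a) (hosc _ _)).trans ha
  unfold mixDefect
  rw [abs_le] at *
  constructor <;> linarith [e1.1, e1.2, e2.1, e2.2, e3.1, e3.2, e4.1, e4.2, e5.1, e5.2]

lemma tendsto_mixDefect_div {ι : Type*} {L : Filter ι} {F : ℝ → ℝ} (hF : ContDiff ℝ 1 F)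
    {l η α β γ y₀ : ℝ} {a b c r y : ι → ℝ} (hr : ∀ i, r i ≠ 0)
    (ha₀ : Tendsto a L (𝓝 0)) (hb₀ : Tendsto b L (𝓝 0)) (hc₀ : Tendsto c L (𝓝 0))
    (ha : Tendsto (fun i => a i / r i) L (𝓝 α)) (hb : Tendsto (fun i => b i / r i) L (𝓝 β))
    (hc : Tendsto (fun i => c i / r i) L (𝓝 γ)) (hy : Tendsto y L (𝓝 y₀)) :
    Tendsto (fun i => mixDefect F l η (a i) (b i) (c i) (y i) / r i) L
      (𝓝 (mixDefectDeriv F l η α β γ y₀)) := by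
  have hs : ∀ x, HasStrictDerivAt F (deriv F x) x := fun x =>
    hF.contDiffAt.hasStrictDerivAt (by norm_num)
  have key : ∀ {p κ : ℝ} {s t : ι → ℝ}, Tendsto s L (𝓝 p) → Tendsto t L (𝓝 p) →
      Tendsto (fun i => (s i - t i) / r i) L (𝓝 κ) →
      Tendsto (fun i => (F (s i) - F (t i)) / r i) L (𝓝 (deriv F p * κ)) :=
    fun h1 h2 h3 => tendsto_sub_div_of_hasStrictDerivAt (hs _) h1 h2 hr h3
  have hyp := hy.add_const η
  have hym := hy.sub_const η
  have cst : ∀ {x : ℝ} {g : ι → ℝ}, Tendsto g L (𝓝 x) → ∀ z : ℝ, x = z → Tendsto g L (𝓝 z) :=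
    fun h _ e => e ▸ h
  have A1 := key (cst (hy.sub hb₀) _ (sub_zero _)) (cst (hy.add hb₀) _ (add_zero _))
    (((hb.const_mul 2).neg).congr fun i => by ring)
  have A2 := key (cst (hyp.sub hb₀) _ (sub_zero _)) hyp (hb.neg.congr fun i => by ring)
  have A3 := key (cst (hym.add hb₀) _ (add_zero _)) hym (hb.congr fun i => by ring)
  have A4 := key (cst (hym.sub hc₀) _ (sub_zero _)) hym (hc.neg.congr fun i => by ring)
  have A5 := key (cst (hyp.add hc₀) _ (add_zero _)) hyp (hc.congr fun i => by ring)
  have A6 := key (cst (hy.sub hc₀) _ (sub_zero _)) (cst (hy.add hc₀) _ (add_zero _))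
    (((hc.const_mul 2).neg).congr fun i => by ring)
  have hl : Tendsto (fun i => l + a i) L (𝓝 l) := cst (ha₀.const_add l) _ (add_zero _)
  have hl' := hl.const_sub 1
  have A7 := ha.mul (((hF.continuous.tendsto _).comp hyp).sub ((hF.continuous.tendsto _).comp hym))
  have := (((((hl.mul_const l).mul A1).add ((hl.mul_const (1 - l)).mul (A2.sub A3))).add
    ((hl'.mul_const l).mul (A4.sub A5))).add ((hl'.mul_const (1 - l)).mul A6)).add A7
  refine this.congr fun i => ?_
  simp only [mixDefect, Function.comp]
  ring

lemma eq_zero_of_tendsto_integral_sq {P : Measure ℝ} [P.IsOpenPosMeasure] {W : ℕ → ℝ → ℝ}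
    {w : ℝ → ℝ} (hWc : ∀ n, Continuous (W n)) (hWi : ∀ n, Integrable (fun x => W n x ^ 2) P)
    (hlim : ∀ x, Tendsto (fun n => W n x) atTop (𝓝 (w x))) (hw : Continuous w)
    (hint : Tendsto (fun n => ∫ x, W n x ^ 2 ∂P) atTop (𝓝 0)) : w = 0 := by
  have hfat := lintegral_liminf_le (μ := P) (u := atTop) (f := fun n x => ENNReal.ofReal (W n x ^ 2))
    (fun n => ((hWc n).pow 2).measurable.ennreal_ofReal)
  have e1 : ∀ x, liminf (fun n => ENNReal.ofReal (W n x ^ 2)) atTop = ENNReal.ofReal (w x ^ 2) :=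
    fun x => (ENNReal.tendsto_ofReal ((hlim x).pow 2)).liminf_eq
  have e2 : liminf (fun n => ∫⁻ x, ENNReal.ofReal (W n x ^ 2) ∂P) atTop = 0 := by
    have h := ENNReal.tendsto_ofReal hint
    rw [ENNReal.ofReal_zero] at h
    refine (h.congr fun n => ?_).liminf_eq
    exact ofReal_integral_eq_lintegral_ofReal (hWi n) (ae_of_all _ fun x => sq_nonneg _)
  simp_rw [e1] at hfat
  have hm : Measurable fun x => ENNReal.ofReal (w x ^ 2) := (hw.pow 2).measurable.ennreal_ofReal
  rw [e2, nonpos_iff_eq_zero, lintegral_eq_zero_iff hm] at hfat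
  refine (hw.ae_eq_iff_eq P continuous_zero).1 (hfat.mono fun x hx => ?_)
  simp only [Pi.zero_apply, ENNReal.ofReal_eq_zero] at hx ⊢
  exact pow_eq_zero_iff (two_ne_zero) |>.1 (le_antisymm hx (sq_nonneg _))

lemma isOpenPosMeasure_of_strictMono {ν : Measure ℝ} [IsProbabilityMeasure ν] {F : ℝ → ℝ}
    (hF : ∀ x : ℝ, F x = (ν (Set.Iic x)).toReal) (hmono : StrictMono F) : ν.IsOpenPosMeasure := by
  refine ⟨fun U hU ⟨x, hx⟩ h0 => ?_⟩
  obtain ⟨ε, hε, hball⟩ := Metric.isOpen_iff.1 hU x hx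
  have hsub : Set.Ioc (x - ε / 2) x ⊆ U := fun y hy => hball <| by
    rw [Real.ball_eq_Ioo]; constructor <;> linarith [hy.1, hy.2]
  have hle : ν (Set.Iic x) ≤ ν (Set.Iic (x - ε / 2)) := by
    rw [← Set.Iic_union_Ioc_eq_Iic (by linarith : x - ε / 2 ≤ x)]
    refine (measure_union_le _ _).trans ?_
    rw [measure_mono_null hsub h0, add_zero]
  have := hmono (by linarith : x - ε / 2 < x)
  rw [hF, hF] at this
  exact this.not_ge (ENNReal.toReal_mono (measure_ne_top _ _) hle)

lemma cdf_neg_of_symmetric {ν : Measure ℝ} [IsProbabilityMeasure ν]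
    (hsym : ν.map (fun x => -x) = ν) {F : ℝ → ℝ}
    (hF : ∀ x : ℝ, F x = (ν (Set.Iic x)).toReal) (hc : Continuous F) (x : ℝ) :
    F (-x) = 1 - F x := by
  have hcdf : ∀ x, ProbabilityTheory.cdf ν x = F x := fun x => by
    rw [hF, ProbabilityTheory.cdf_eq_real]; rfl
  have hcdf' : (ProbabilityTheory.cdf ν : ℝ → ℝ) = F := funext hcdf
  have h1 : ν (Set.Iic (-x)) = ν (Set.Ici x) := by
    conv_lhs => rw [← hsym]
    rw [Measure.map_apply measurable_neg measurableSet_Iic]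
    congr 1
    ext y
    simp
  have h2 : ν (Set.Ici x) = ENNReal.ofReal (1 - F x) := by
    rw [← ProbabilityTheory.measure_cdf ν,
      StieltjesFunction.measure_Ici _ (ProbabilityTheory.tendsto_cdf_atTop ν), hcdf',
      hc.continuousAt.continuousWithinAt.leftLim_eq]
  have h3 : F x ≤ 1 := hcdf x ▸ ProbabilityTheory.cdf_le_one ν x
  rw [hF (-x), h1, h2, ENNReal.toReal_ofReal (by linarith)]

lemma continuous_tsum_neg_pow_mul {q C : ℝ} (hq₀ : 0 ≤ q) (hq₁ : q < 1) {g : ℕ → ℝ → ℝ}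
    (hg : ∀ k, Continuous (g k)) (hC : ∀ k x, |g k x| ≤ C) :
    Continuous fun x => ∑' k : ℕ, (-q) ^ k * g k x := by
  refine continuous_tsum (u := fun k => q ^ k * C) (fun k => (hg k).const_mul _)
    ((summable_geometric_of_lt_one hq₀ hq₁).mul_right C) fun k x => ?_
  rw [norm_mul, norm_pow, norm_neg, Real.norm_of_nonneg hq₀]
  exact mul_le_mul_of_nonneg_left (hC k x) (by positivity)

/-- A bounded function whose alternating geometric series along translates vanishes is zero. -/
lemma eq_zero_of_tsum_translate_eq_zero {q : ℝ} (hq₀ : 0 ≤ q) (hq₁ : q < 1) {g : ℝ → ℝ} {C η : ℝ}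
    (hg : ∀ x, |g x| ≤ C) (h : ∀ x, ∑' k : ℕ, (-q) ^ k * g (x - k * η) = 0) (x : ℝ) :
    g x = 0 := by
  have e := hasSum_neg_pow_mul_add hq₀ hq₁ (g := fun k : ℕ => g (x - k * η)) (fun k => hg _)
  have e1 := (summable_neg_pow_mul hq₀ hq₁ (g := fun k : ℕ => g (x - k * η)) (fun k => hg _)).hasSum
  have e2 := (summable_neg_pow_mul hq₀ hq₁ (g := fun k : ℕ => g (x - η - k * η))
    (fun k => hg _)).hasSum.mul_left q
  rw [h] at e1 e2
  have e3 := e1.add e2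
  rw [mul_zero, add_zero] at e3
  have e4 := e.unique (e3.congr_fun fun k => by
    rw [show x - ((k + 1 : ℕ) : ℝ) * η = x - η - k * η by push_cast; ring]; ring)
  simpa using e4

lemma exists_abs_mixDefectDeriv_le {F : ℝ → ℝ} {M : ℝ} (hM : ∀ x, |deriv F x| ≤ M)
    (hosc : ∀ p q, |F p - F q| ≤ 1) (l η α β γ : ℝ) :
    ∃ C, ∀ y, |mixDefectDeriv F l η α β γ y| ≤ C := by
  have key : ∀ {g h : ℝ → ℝ}, (∃ C, ∀ y, |g y| ≤ C) → (∃ C, ∀ y, |h y| ≤ C) →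
      ∃ C, ∀ y, |g y + h y| ≤ C := fun ⟨C, hC⟩ ⟨D, hD⟩ =>
    ⟨C + D, fun y => (abs_add_le _ _).trans (add_le_add (hC y) (hD y))⟩
  have hmul : ∀ {g : ℝ → ℝ} (c : ℝ), (∃ C, ∀ y, |g y| ≤ C) → ∃ C, ∀ y, |c * g y| ≤ C :=
    fun c ⟨C, hC⟩ => ⟨|c| * C, fun y => by
      rw [abs_mul]; exact mul_le_mul_of_nonneg_left (hC y) (abs_nonneg c)⟩
  have hd : ∀ s, ∃ C, ∀ y, |deriv F (y + s)| ≤ C := fun s => ⟨M, fun y => hM _⟩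
  have hE : ∃ C, ∀ y, |F (y + η) - F (y - η)| ≤ C := ⟨1, fun y => hosc _ _⟩
  obtain ⟨C, hC⟩ := key (key (key (hmul (-2 * (l * l * β + (1 - l) * (1 - l) * γ)) (hd 0))
    (hmul (-(l * (1 - l) * (β + γ))) (hd η))) (hmul (-(l * (1 - l) * (β + γ))) (hd (-η))))
    (hmul α hE)
  refine ⟨C, fun y => le_of_eq_of_le (congrArg _ ?_) (hC y)⟩
  simp only [mixDefectDeriv, add_zero, ← sub_eq_add_neg]
  ring

lemma direction_eq_zero_of_mixDefectDeriv_eq_zero {F : ℝ → ℝ} (hF : Differentiable ℝ F)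
    (hi : Integrable (deriv F)) (hne : ∫ x, deriv F x ≠ 0) {l η α β γ : ℝ} (hl₀ : 0 < l)
    (hl₁ : l < 1 / 2) (hη : η ≠ 0) (h : ∀ y, mixDefectDeriv F l η α β γ y = 0) :
    α = 0 ∧ β = 0 ∧ γ = 0 := by
  obtain ⟨h1, h2, h3⟩ := eq_zero_of_increment_eq (a := α)
    (b := 2 * (l * l * β + (1 - l) * (1 - l) * γ)) (c := l * (1 - l) * (β + γ))
    (fun x => (hF x).hasDerivAt) hi hne hη fun x => by
      have := h x
      simp only [mixDefectDeriv] at this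
      linear_combination this
  have hs : β + γ = 0 := by
    have : l * (1 - l) ≠ 0 := mul_ne_zero hl₀.ne' (by linarith)
    exact (mul_eq_zero.1 h3).resolve_left this
  have hγ : γ = 0 := by
    have : (1 - 2 * l) * γ = 0 := by linear_combination h2 / 2 - l * l * hs
    exact (mul_eq_zero.1 this).resolve_left (by linarith)
  exact ⟨h1, by linarith, hγ⟩

lemma integrable_deriv_of_monotone {F : ℝ → ℝ} (hF : ContDiff ℝ 1 F) (hm : Monotone F)
    (hosc : ∀ p q, |F p - F q| ≤ 1) : Integrable (deriv F) := by
  refine integrable_of_intervalIntegral_norm_bounded (l := atTop) (a := fun n : ℕ => -(n : ℝ))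
    (b := fun n : ℕ => (n : ℝ)) 1
    (fun n => (hF.continuous_deriv_one.integrableOn_Icc).mono_set Set.Ioc_subset_Icc_self)
    (tendsto_neg_atTop_atBot.comp tendsto_natCast_atTop_atTop) tendsto_natCast_atTop_atTop
    (Eventually.of_forall fun n => ?_)
  simp_rw [Real.norm_of_nonneg hm.deriv_nonneg]
  rw [intervalIntegral.integral_deriv_eq_sub
    (fun y _ => (hF.differentiable one_ne_zero).differentiableAt)
    (hF.continuous_deriv_one.intervalIntegrable _ _)]
  exact (le_abs_self _).trans (hosc _ _)

/-- If the contrast is negligible against `r²` along parameters `θ₀ + (a, b, c)` with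
`(a, b, c) / r → (α, β, γ)`, then the limiting direction vanishes. -/
lemma limit_direction_eq_zero {F : ℝ → ℝ} (hF : ContDiff ℝ 1 F) (hm : Monotone F) {M : ℝ}
    (hM : ∀ x, |deriv F x| ≤ M) (hF₀ : ∀ x, 0 ≤ F x) (hF₁ : ∀ x, F x ≤ 1)
    (hsymm : ∀ x, F (-x) = 1 - F x) (hne : ∫ x, deriv F x ≠ 0)
    {P : Measure ℝ} [IsFiniteMeasure P] [P.IsOpenPosMeasure]
    {l m₁ m₂ : ℝ} (hl₀ : 0 < l) (hl₁ : l < 1 / 2) (hm₁₂ : m₁ ≠ m₂) {L : ℝ} (hL : L < 1 / 2)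
    {a b c r : ℕ → ℝ} {α β γ : ℝ} (hr : ∀ n, 0 < r n) (har : ∀ n, |a n| ≤ r n)
    (hbr : ∀ n, |b n| ≤ r n) (hcr : ∀ n, |c n| ≤ r n) (hla₀ : ∀ n, 0 ≤ l + a n)
    (hla₁ : ∀ n, l + a n ≤ L) (hr₀ : Tendsto r atTop (𝓝 0))
    (ha : Tendsto (fun n => a n / r n) atTop (𝓝 α)) (hb : Tendsto (fun n => b n / r n) atTop (𝓝 β))
    (hc : Tendsto (fun n => c n / r n) atTop (𝓝 γ))
    (hK : Tendsto (fun n => (∫ x, (Aop (l + a n) (m₁ + b n) (m₂ + c n)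
      (Sr (Ainv (l + a n) (m₁ + b n) (m₂ + c n) (Aop l m₁ m₂ F))) x - Aop l m₁ m₂ F x) ^ 2 ∂P) /
        r n ^ 2) atTop (𝓝 0)) : α = 0 ∧ β = 0 ∧ γ = 0 := by
  have hosc : ∀ p q, |F p - F q| ≤ 1 := fun p q => by
    rw [abs_le]; constructor <;> linarith [hF₀ p, hF₀ q, hF₁ p, hF₁ q]
  have hLip := abs_sub_le_of_abs_deriv_le (hF.differentiable one_ne_zero) hM
  have hM₀ : 0 ≤ M := (abs_nonneg _).trans (hM 0)
  set C := 8 * M + 1 with hC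
  have hC₀ : 0 ≤ C := by positivity
  have h1l : ∀ n, 0 < 1 - (l + a n) := fun n => by linarith [hla₁ n]
  set η := m₂ - m₁ with hη
  set q : ℕ → ℝ := fun n => (l + a n) / (1 - (l + a n)) with hq
  have hq₀ : ∀ n, 0 ≤ q n := fun n => div_nonneg (hla₀ n) (h1l n).le
  have hqL : ∀ n, q n ≤ L / (1 - L) := fun n =>
    div_le_div₀ ((hla₀ n).trans (hla₁ n)) (hla₁ n) (by linarith) (by linarith [hla₁ n])
  have hL1 : L / (1 - L) < 1 := by rw [div_lt_one (by linarith)]; linarith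
  have hq₁ : ∀ n, q n < 1 := fun n => (hqL n).trans_lt hL1
  have hlq₀ : 0 ≤ l / (1 - l) := div_nonneg hl₀.le (by linarith)
  have hlq₁ : l / (1 - l) < 1 := by rw [div_lt_one (by linarith)]; linarith
  have hsq : ∀ {t : ℕ → ℝ}, (∀ n, |t n| ≤ r n) → Tendsto t atTop (𝓝 0) := fun ht =>
    squeeze_zero_norm ht hr₀
  have ha₀ := hsq har
  have hb₀ := hsq hbr
  have hc₀ := hsq hcr
  have hAbd : ∀ s t x, |Aop l s t F x| ≤ 1 := fun s t x => by
    have h3 := mul_nonneg hl₀.le (hF₀ (x - s))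
    have h4 := mul_nonneg (by linarith : 0 ≤ 1 - l) (hF₀ (x - t))
    have h5 := mul_le_of_le_one_right hl₀.le (hF₁ (x - s))
    have h6 := mul_le_of_le_one_right (by linarith : 0 ≤ 1 - l) (hF₁ (x - t))
    simp only [Aop]
    rw [abs_of_nonneg (by linarith)]
    linarith
  have hrefl : ∀ x, Aop l m₁ m₂ F (-x) = 1 - Aop l (-m₁) (-m₂) F x := fun x => by
    simp only [Aop]
    rw [show -x - m₁ = -(x - -m₁) by ring, show -x - m₂ = -(x - -m₂) by ring, hsymm, hsymm]
    ring
  set D : ℕ → ℝ → ℝ := fun n y => mixDefect F l η (a n) (b n) (c n) y / r n with hD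
  have hDbd : ∀ n y, |D n y| ≤ C := fun n y => by
    rw [hD]
    simp only
    rw [abs_div, abs_of_pos (hr n), div_le_iff₀ (hr n)]
    exact abs_mixDefect_le hM₀ hLip hosc hl₀.le (by linarith) (hla₀ n) (by linarith [h1l n])
      (har n) (hbr n) (hcr n) η y
  have hFc := hF.continuous
  have hDc : ∀ n, Continuous (D n) := fun n => by
    simp only [hD, mixDefect]
    fun_prop
  set W : ℕ → ℝ → ℝ := fun n x => 1 / (1 - (l + a n)) * ∑' k : ℕ, (-(q n)) ^ k *
    D n (x - (m₂ + c n) - k * (m₂ + c n - (m₁ + b n))) with hW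
  have hWeq : ∀ n x, W n x = (Aop (l + a n) (m₁ + b n) (m₂ + c n)
      (Sr (Ainv (l + a n) (m₁ + b n) (m₂ + c n) (Aop l m₁ m₂ F))) x - Aop l m₁ m₂ F x) / r n := by
    intro n x
    rw [Aop_Sr_Ainv_sub (hla₀ n) (by linarith [hla₁ n]) (hAbd m₁ m₂) (hAbd _ _) hrefl]
    simp only [Aop_sub_Aop_eq_mixDefect, hW, hD, mul_div_assoc, ← tsum_div_const, hq, hη]
  have hWc : ∀ n, Continuous (W n) := fun n =>
    (continuous_tsum_neg_pow_mul (hq₀ n) (hq₁ n) (fun k => (hDc n).comp (by fun_prop))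
      (fun k x => hDbd n _)).const_mul _
  have hWb : ∀ n x, ‖W n x ^ 2‖ ≤ (1 / (1 - (l + a n)) * (C / (1 - q n))) ^ 2 := by
    intro n x
    rw [norm_pow]
    gcongr
    rw [hW]
    simp only
    rw [norm_mul, Real.norm_of_nonneg (one_div_nonneg.2 (h1l n).le)]
    refine mul_le_mul_of_nonneg_left ?_ (one_div_nonneg.2 (h1l n).le)
    have hg := (hasSum_geometric_of_lt_one (hq₀ n) (hq₁ n)).mul_left C
    refine tsum_of_norm_bounded hg fun k => ?_
    rw [norm_mul, norm_pow, norm_neg, Real.norm_of_nonneg (hq₀ n), mul_comm]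
    exact mul_le_mul_of_nonneg_right (hDbd n _) (pow_nonneg (hq₀ n) k)
  have hWi : ∀ n, Integrable (fun x => W n x ^ 2) P := fun n =>
    Integrable.of_bound ((hWc n).pow 2).aestronglyMeasurable _ (ae_of_all _ (hWb n))
  have hWint : Tendsto (fun n => ∫ x, W n x ^ 2 ∂P) atTop (𝓝 0) := by
    refine hK.congr fun n => ?_
    simp_rw [hWeq, div_pow, integral_div]
  set D' := mixDefectDeriv F l η α β γ with hD'
  obtain ⟨C', hC'⟩ := exists_abs_mixDefectDeriv_le hM hosc l η α β γ
  set w : ℝ → ℝ := fun x => 1 / (1 - l) * ∑' k : ℕ, (-(l / (1 - l))) ^ k *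
    D' (x - m₂ - k * η) with hw
  have hF'c := hF.continuous_deriv_one
  have hD'c : Continuous D' := by
    unfold D' mixDefectDeriv
    fun_prop
  have hwc : Continuous w :=
    (continuous_tsum_neg_pow_mul hlq₀ hlq₁ (fun k => hD'c.comp (by fun_prop))
      (fun k x => hC' _)).const_mul _
  have hla : Tendsto (fun n => l + a n) atTop (𝓝 l) := by simpa using ha₀.const_add l
  have h1la : Tendsto (fun n => 1 - (l + a n)) atTop (𝓝 (1 - l)) := hla.const_sub 1
  have h1l_ne : 1 - l ≠ 0 := by linarith
  have hlim : ∀ x, Tendsto (fun n => W n x) atTop (𝓝 (w x)) := by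
    intro x
    refine (tendsto_const_nhds.div h1la h1l_ne).mul ?_
    refine tendsto_tsum_of_dominated_convergence (bound := fun k => (L / (1 - L)) ^ k * C)
      ((summable_geometric_of_lt_one ((hq₀ 0).trans (hqL 0)) hL1).mul_right C) (fun k => ?_)
      (Eventually.of_forall fun n k => ?_)
    · refine ((hla.div h1la h1l_ne).neg.pow k).mul ?_
      refine tendsto_mixDefect_div hF (fun n => (hr n).ne') ha₀ hb₀ hc₀ ha hb hc ?_
      have := ((hc₀.const_add m₂).const_sub x).sub
        (((hc₀.const_add m₂).sub (hb₀.const_add m₁)).const_mul (k : ℝ))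
      simpa using this
    · rw [norm_mul, norm_pow, norm_neg, Real.norm_of_nonneg (hq₀ n)]
      exact mul_le_mul (pow_le_pow_left₀ (hq₀ n) (hqL n) k) (hDbd n _) (norm_nonneg _)
        (pow_nonneg ((hq₀ 0).trans (hqL 0)) k)
  have hw0 := eq_zero_of_tendsto_integral_sq hWc hWi hlim hwc hWint
  have hD'0 : ∀ y, D' y = 0 := eq_zero_of_tsum_translate_eq_zero hlq₀ hlq₁ hC' fun x => by
    have := congrFun hw0 (x + m₂)
    simp only [hw, add_sub_cancel_right, Pi.zero_apply] at this
    exact (mul_eq_zero.1 this).resolve_left (one_div_ne_zero h1l_ne)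
  exact direction_eq_zero_of_mixDefectDeriv_eq_zero (hF.differentiable one_ne_zero)
    (integrable_deriv_of_monotone hF hm hosc) hne hl₀ hl₁ (sub_ne_zero.2 hm₁₂.symm) hD'0

/-- Local quadratic lower bound for the contrast function at the true parameter. -/
theorem stmt_16
    (ν : Measure ℝ) (hprob : IsProbabilityMeasure ν) (hsym : ν.map (fun x => -x) = ν)
    (F₀ : ℝ → ℝ) (hF₀ : ∀ x : ℝ, F₀ x = (ν (Set.Iic x)).toReal)
    -- condition C2
    (hmono : StrictMono F₀) (hC2 : ContDiff ℝ 2 F₀)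
    (hC2' : Integrable (deriv (deriv F₀)) (volume : Measure ℝ))
    (lam₀ mu₁₀ mu₂₀ : ℝ) (hlam₀ : lam₀ ∈ Set.Ico (0 : ℝ) (1 / 2)) (hmu₀ : mu₁₀ ≠ mu₂₀)
    (G : ℝ → ℝ) (hG : ∀ x : ℝ, G x = lam₀ * F₀ (x - mu₁₀) + (1 - lam₀) * F₀ (x - mu₂₀))
    -- the Lebesgue–Stieltjes measure of G is the mixture measure
    (P : Measure ℝ)
    (hP : P = ENNReal.ofReal lam₀ • ν.map (fun x => x + mu₁₀)
        + ENNReal.ofReal (1 - lam₀) • ν.map (fun x => x + mu₂₀))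
    (K : ℝ × ℝ × ℝ → ℝ)
    (hK : ∀ θ : ℝ × ℝ × ℝ, K θ = ∫ x : ℝ,
      (Aop θ.1 θ.2.1 θ.2.2 (Sr (Ainv θ.1 θ.2.1 θ.2.2 G)) x - G x) ^ 2 ∂P)
    -- the parameter set Θ and interiority of θ₀
    (d : ℝ) (hd : d ∈ Set.Ioo (0 : ℝ) (1 / 2))
    (𝒳 : Set (ℝ × ℝ)) (h𝒳c : IsCompact 𝒳) (h𝒳Δ : ∀ p ∈ 𝒳, p.1 ≠ p.2)
    (Θ : Set (ℝ × ℝ × ℝ))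
    (hΘ : Θ = {θ : ℝ × ℝ × ℝ | θ.1 ∈ Set.Icc (0 : ℝ) (1 / 2 - d) ∧ θ.2 ∈ 𝒳})
    (hint : (lam₀, mu₁₀, mu₂₀) ∈ interior Θ) :
    ∃ η > (0 : ℝ), ∃ a > (0 : ℝ),
      ∀ u : ℝ × ℝ × ℝ, enorm3 u < η → (lam₀, mu₁₀, mu₂₀) + u ∈ Θ →
        K ((lam₀, mu₁₀, mu₂₀) + u) ≥ a * (enorm3 u) ^ 2 := by
  have hc := hC2.continuous
  have hC1 : ContDiff ℝ 1 F₀ := hC2.of_le (by norm_num)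
  have hcdf : (ProbabilityTheory.cdf ν : ℝ → ℝ) = F₀ := funext fun x => by
    rw [hF₀, ProbabilityTheory.cdf_eq_real]; rfl
  have hnn : ∀ x, 0 ≤ F₀ x := fun x => hcdf ▸ ProbabilityTheory.cdf_nonneg ν x
  have hle : ∀ x, F₀ x ≤ 1 := fun x => hcdf ▸ ProbabilityTheory.cdf_le_one ν x
  have hbot : Tendsto F₀ atBot (𝓝 0) := hcdf ▸ ProbabilityTheory.tendsto_cdf_atBot ν
  have htop : Tendsto F₀ atTop (𝓝 1) := hcdf ▸ ProbabilityTheory.tendsto_cdf_atTop ν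
  have hne : ∫ x, deriv F₀ x ≠ 0 := by
    rw [integral_of_hasDerivAt_of_tendsto
      (fun x => (hC1.differentiable one_ne_zero).differentiableAt.hasDerivAt)
      (integrable_deriv_of_monotone hC1 hmono.monotone fun p q => by
        rw [abs_le]; constructor <;> linarith [hnn p, hnn q, hle p, hle q]) hbot htop]
    norm_num
  have hdC1 : ContDiff ℝ 1 (deriv F₀) := ((contDiff_succ_iff_deriv (n := 1)).1 hC2).2.2
  obtain ⟨M, hM⟩ := bounded_of_integrable_deriv hdC1 hC2'
  have hGA : G = Aop lam₀ mu₁₀ mu₂₀ F₀ := funext hG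
  have hνpos : ν.IsOpenPosMeasure := isOpenPosMeasure_of_strictMono hF₀ hmono
  have hPpos : P.IsOpenPosMeasure := by
    have h1 : (ν.map (fun x => x + mu₂₀)).IsOpenPosMeasure :=
      (continuous_add_const mu₂₀).isOpenPosMeasure_map (add_right_surjective mu₂₀)
    have h2 := Measure.isOpenPosMeasure_smul (ν.map (fun x => x + mu₂₀))
      (c := ENNReal.ofReal (1 - lam₀))
      (ENNReal.ofReal_pos.2 (by linarith [hlam₀.2])).ne'
    exact (hP ▸ Measure.le_add_left le_rfl :
      ENNReal.ofReal (1 - lam₀) • ν.map (fun x => x + mu₂₀) ≤ P).isOpenPosMeasure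
  have hPfin : IsFiniteMeasure P := by
    rw [hP]
    have h1 := (ν.map (fun x => x + mu₁₀)).smul_finite (c := ENNReal.ofReal lam₀)
      ENNReal.ofReal_ne_top
    have h2 := (ν.map (fun x => x + mu₂₀)).smul_finite (c := ENNReal.ofReal (1 - lam₀))
      ENNReal.ofReal_ne_top
    infer_instance
  have hlam_pos : 0 < lam₀ := by
    have hcont : Continuous fun t : ℝ => (lam₀ + t, mu₁₀, mu₂₀) := by fun_prop
    have h0 : ∀ᶠ t in 𝓝 (0 : ℝ), (lam₀ + t, mu₁₀, mu₂₀) ∈ Θ :=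
      hcont.continuousAt.eventually (by simpa using mem_interior_iff_mem_nhds.1 hint)
    obtain ⟨ε, hε, hball⟩ := Metric.eventually_nhds_iff.1 h0
    have := hball (y := -(ε / 2)) (by
      rw [Real.dist_eq, sub_zero, abs_neg, abs_of_pos (by positivity)]; linarith)
    rw [hΘ] at this
    linarith [this.1.1]
  by_contra! hcon
  choose u hu_lt hu_mem hu_K using fun n : ℕ =>
    hcon (1 / ((n : ℝ) + 1)) (by positivity) (1 / ((n : ℝ) + 1)) (by positivity)
  have hsq : ∀ v : ℝ × ℝ × ℝ, enorm3 v ^ 2 = v.1 ^ 2 + v.2.1 ^ 2 + v.2.2 ^ 2 := fun v =>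
    Real.sq_sqrt (by positivity)
  have hr_nn : ∀ n, 0 ≤ enorm3 (u n) := fun n => Real.sqrt_nonneg _
  have hK_nn : ∀ θ, 0 ≤ K θ := fun θ => hK θ ▸ integral_nonneg fun x => sq_nonneg _
  have hr : ∀ n, 0 < enorm3 (u n) := fun n => by
    refine (hr_nn n).lt_of_ne fun h => ?_
    have := hu_K n
    rw [← h] at this
    norm_num at this
    exact this.not_ge (hK_nn _)
  have h1 : ∀ n, |(u n).1| ≤ enorm3 (u n) := fun n =>
    abs_le_of_sq_le_sq (by rw [hsq]; nlinarith [sq_nonneg (u n).2.1, sq_nonneg (u n).2.2]) (hr_nn n)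
  have h2 : ∀ n, |(u n).2.1| ≤ enorm3 (u n) := fun n =>
    abs_le_of_sq_le_sq (by rw [hsq]; nlinarith [sq_nonneg (u n).1, sq_nonneg (u n).2.2]) (hr_nn n)
  have h3 : ∀ n, |(u n).2.2| ≤ enorm3 (u n) := fun n =>
    abs_le_of_sq_le_sq (by rw [hsq]; nlinarith [sq_nonneg (u n).1, sq_nonneg (u n).2.1]) (hr_nn n)
  set v : ℕ → ℝ × ℝ × ℝ := fun n =>
    ((u n).1 / enorm3 (u n), (u n).2.1 / enorm3 (u n), (u n).2.2 / enorm3 (u n)) with hv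
  have hv_mem : ∀ n, v n ∈ Set.Icc (-1 : ℝ) 1 ×ˢ (Set.Icc (-1 : ℝ) 1 ×ˢ Set.Icc (-1 : ℝ) 1) := by
    have key : ∀ n z, |z| ≤ enorm3 (u n) → z / enorm3 (u n) ∈ Set.Icc (-1 : ℝ) 1 :=
      fun n z hz => abs_le.1 (by rwa [abs_div, abs_of_pos (hr n), div_le_one (hr n)])
    exact fun n => ⟨key n _ (h1 n), key n _ (h2 n), key n _ (h3 n)⟩
  obtain ⟨v₀, -, φ, hφ, hlim⟩ :=
    (isCompact_Icc.prod (isCompact_Icc.prod isCompact_Icc)).tendsto_subseq hv_mem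
  have l1 := (continuous_fst.tendsto v₀).comp hlim
  have l2 := ((continuous_fst.comp continuous_snd).tendsto v₀).comp hlim
  have l3 := ((continuous_snd.comp continuous_snd).tendsto v₀).comp hlim
  have hone : Tendsto (fun n => 1 / ((φ n : ℝ) + 1)) atTop (𝓝 0) :=
    tendsto_one_div_add_atTop_nhds_zero_nat.comp hφ.tendsto_atTop
  have hmem : ∀ n, 0 ≤ lam₀ + (u n).1 ∧ lam₀ + (u n).1 ≤ 1 / 2 - d := fun n => by
    have := hu_mem n
    rw [hΘ] at this
    exact this.1
  obtain ⟨e1, e2, e3⟩ := limit_direction_eq_zero (P := P) hC1 hmono.monotone hM hnn hle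
    (cdf_neg_of_symmetric hsym hF₀ hc) hne hlam_pos hlam₀.2 hmu₀ (L := 1 / 2 - d)
    (by linarith [hd.1]) (a := fun n => (u (φ n)).1) (b := fun n => (u (φ n)).2.1)
    (c := fun n => (u (φ n)).2.2) (r := fun n => enorm3 (u (φ n))) (fun n => hr _)
    (fun n => h1 _) (fun n => h2 _) (fun n => h3 _) (fun n => (hmem _).1) (fun n => (hmem _).2)
    (squeeze_zero (fun n => hr_nn _) (fun n => (hu_lt _).le) hone) l1 l2 l3
    (squeeze_zero (fun n => div_nonneg (integral_nonneg fun x => sq_nonneg _) (sq_nonneg _))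
      (fun n => by
        rw [div_le_iff₀ (pow_pos (hr _) 2)]
        have := hu_K (φ n)
        rw [hK, hGA] at this
        exact this.le) hone)
  have hunit : ∀ n, (v n).1 ^ 2 + (v n).2.1 ^ 2 + (v n).2.2 ^ 2 = 1 := fun n => by
    simp only [hv, div_pow, ← add_div]
    rw [← hsq, div_self (pow_pos (hr n) 2).ne']
  have hlim1 := ((l1.pow 2).add (l2.pow 2)).add (l3.pow 2)
  rw [e1, e2, e3] at hlim1
  have := tendsto_nhds_unique hlim1 (tendsto_const_nhds.congr fun n => (hunit (φ n)).symm)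
  norm_num at this
end
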